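/- Let m ≥ 2, write r = √(2m − 1), and let P^B be the NBCRW transition matrix on the rose graph R_m^4 with N_m = 3m + 1 vertices: from the hub, probability 1/(2m) to each internal node; from each internal node, probability m/(m + r) to the hub and r/(m + r) to its peripheral neighbor; from each peripheral node, probability 1/2 to each of its two internal neighbors. Suppose T : V × V → ℝ satisfies T(j,j) = 0 for every vertex j and T(i,j) = 1 + Σ_k P^B(i,k)·T(k,j) for all vertices i ≠ j. Then the global mean hitting time equals ⟨T⟩^B = (1/(N_m(N_m − 1)))·Σ_i Σ_j T(i,j) = (2m³ + 12m² − 14m + 4)/((3m + 1)·√(2m − 1)) + (36m² − 8m)/(3(3m + 1)). -/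

import Mathlib

open Finset
/-- Transition matrix of the non-backtracking centrality based random walk (NBCRW) on the
rose graph `R_m^4`: from the hub (vertex `0`) probability `1/(2m)` to each internal node;
from each internal node probability `m/(m+√(2m-1))` to the hub and `√(2m-1)/(m+√(2m-1))`
to its peripheral neighbor; from each peripheral node probability `1/2` to each of its
two internal neighbors. -/
noncomputable def rosePB (m : ℕ) : Matrix (Fin (3 * m + 1)) (Fin (3 * m + 1)) ℝ :=
  fun i j =>
    if (i : ℕ) = 0 ∧ (j : ℕ) % 3 ≠ 0 then 1 / (2 * (m : ℝ))
    else if (i : ℕ) % 3 ≠ 0 ∧ (j : ℕ) = 0 then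
      (m : ℝ) / ((m : ℝ) + Real.sqrt (2 * (m : ℝ) - 1))
    else if ((i : ℕ) % 3 = 1 ∧ (j : ℕ) = (i : ℕ) + 2)
        ∨ ((i : ℕ) % 3 = 2 ∧ (j : ℕ) = (i : ℕ) + 1) then
      Real.sqrt (2 * (m : ℝ) - 1) / ((m : ℝ) + Real.sqrt (2 * (m : ℝ) - 1))
    else if (i : ℕ) % 3 = 0 ∧ (i : ℕ) ≠ 0
        ∧ ((j : ℕ) + 2 = (i : ℕ) ∨ (j : ℕ) + 1 = (i : ℕ)) then 1 / 2
    else 0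

/-- The first internal vertex of the petal `p` of the rose graph. -/
def roseLeft {m : ℕ} (p : Fin m) : Fin (3 * m + 1) := ⟨3 * p + 1, by omega⟩

/-- The second internal vertex of the petal `p` of the rose graph. -/
def roseRight {m : ℕ} (p : Fin m) : Fin (3 * m + 1) := ⟨3 * p + 2, by omega⟩

/-- The peripheral vertex of the petal `p` of the rose graph. -/
def roseTip {m : ℕ} (p : Fin m) : Fin (3 * m + 1) := ⟨3 * p + 3, by omega⟩

/-- A sum over the vertices of the rose graph, split into the hub and the petals. -/
theorem sum_rose (m : ℕ) (f : Fin (3 * m + 1) → ℝ) :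
    ∑ i, f i = f 0 + ∑ p : Fin m, (f (roseLeft p) + f (roseRight p) + f (roseTip p)) := by
  have key : ∀ (F : ℕ → ℝ) (n : ℕ), ∑ i ∈ range (3 * n + 1), F i =
      F 0 + ∑ p ∈ range n, (F (3 * p + 1) + F (3 * p + 2) + F (3 * p + 3)) := by
    intro F n
    induction n with
    | zero => simp
    | succ n ih =>
      rw [show 3 * (n + 1) + 1 = 3 * n + 1 + 1 + 1 + 1 by ring, sum_range_succ, sum_range_succ,
        sum_range_succ, ih, sum_range_succ]
      ring
  let F : ℕ → ℝ := fun i => if h : i < 3 * m + 1 then f ⟨i, h⟩ else 0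
  have hF : ∀ i : Fin (3 * m + 1), F i = f i := fun i => dif_pos i.isLt
  calc ∑ i, f i = ∑ i : Fin (3 * m + 1), F i := by simp only [hF]
    _ = F 0 + ∑ p : Fin m, (F (3 * p + 1) + F (3 * p + 2) + F (3 * p + 3)) := by
      rw [Fin.sum_univ_eq_sum_range, key,
        Fin.sum_univ_eq_sum_range (fun p => F (3 * p + 1) + F (3 * p + 2) + F (3 * p + 3))]
    _ = _ := by
      rw [← hF 0]
      congr 1
      exact sum_congr rfl fun p _ => by rw [← hF, ← hF, ← hF]; rfl

section Step

variable {m : ℕ} (u : Fin (3 * m + 1) → ℝ)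

theorem rosePB_hub :
    ∑ k, rosePB m 0 k * u k
      = 1 / (2 * (m : ℝ)) * ∑ p : Fin m, (u (roseLeft p) + u (roseRight p)) := by
  rw [sum_rose, mul_sum]
  have h0 : rosePB m 0 0 = 0 := by simp [rosePB]
  rw [h0, zero_mul, zero_add]
  refine sum_congr rfl fun p _ => ?_
  have h1 : rosePB m 0 (roseLeft p) = 1 / (2 * (m : ℝ)) := by
    simp [rosePB, roseLeft, Nat.add_mod]
  have h2 : rosePB m 0 (roseRight p) = 1 / (2 * (m : ℝ)) := by
    simp [rosePB, roseRight, Nat.add_mod]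
  have h3 : rosePB m 0 (roseTip p) = 0 := by
    simp [rosePB, roseTip]
  rw [h1, h2, h3]
  ring

theorem rosePB_left (p : Fin m) :
    ∑ k, rosePB m (roseLeft p) k * u k
      = (m : ℝ) / (m + √(2 * (m : ℝ) - 1)) * u 0
        + √(2 * (m : ℝ) - 1) / (m + √(2 * (m : ℝ) - 1)) * u (roseTip p) := by
  have hp : ∀ t : Fin m, t ≠ p → (t : ℕ) ≠ p := fun t ht h => ht (Fin.ext h)
  rw [sum_rose, sum_eq_single p]
  · have h0 : rosePB m (roseLeft p) 0 = (m : ℝ) / (m + √(2 * (m : ℝ) - 1)) := by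
      simp [rosePB, roseLeft, Nat.add_mod]
    have h1 : rosePB m (roseLeft p) (roseLeft p) = 0 := by
      simp [rosePB, roseLeft, Nat.add_mod]
    have h2 : rosePB m (roseLeft p) (roseRight p) = 0 := by
      simp [rosePB, roseLeft, roseRight, Nat.add_mod]
    have h3 : rosePB m (roseLeft p) (roseTip p)
        = √(2 * (m : ℝ) - 1) / (m + √(2 * (m : ℝ) - 1)) := by
      simp [rosePB, roseLeft, roseTip, Nat.add_mod]
    rw [h0, h1, h2, h3]
    ring
  · intro t _ ht
    have := hp t ht
    have h1 : rosePB m (roseLeft p) (roseLeft t) = 0 := by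
      simp [rosePB, roseLeft, Nat.add_mod]; omega
    have h2 : rosePB m (roseLeft p) (roseRight t) = 0 := by
      simp [rosePB, roseLeft, roseRight, Nat.add_mod]; omega
    have h3 : rosePB m (roseLeft p) (roseTip t) = 0 := by
      simp [rosePB, roseLeft, roseTip, Nat.add_mod]; omega
    rw [h1, h2, h3]
    ring
  · simp

theorem rosePB_right (p : Fin m) :
    ∑ k, rosePB m (roseRight p) k * u k
      = (m : ℝ) / (m + √(2 * (m : ℝ) - 1)) * u 0
        + √(2 * (m : ℝ) - 1) / (m + √(2 * (m : ℝ) - 1)) * u (roseTip p) := by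
  have hp : ∀ t : Fin m, t ≠ p → (t : ℕ) ≠ p := fun t ht h => ht (Fin.ext h)
  rw [sum_rose, sum_eq_single p]
  · have h0 : rosePB m (roseRight p) 0 = (m : ℝ) / (m + √(2 * (m : ℝ) - 1)) := by
      simp [rosePB, roseRight, Nat.add_mod]
    have h1 : rosePB m (roseRight p) (roseRight p) = 0 := by
      simp [rosePB, roseRight, Nat.add_mod]
    have h2 : rosePB m (roseRight p) (roseLeft p) = 0 := by
      simp [rosePB, roseLeft, roseRight, Nat.add_mod]
    have h3 : rosePB m (roseRight p) (roseTip p)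
        = √(2 * (m : ℝ) - 1) / (m + √(2 * (m : ℝ) - 1)) := by
      simp [rosePB, roseRight, roseTip, Nat.add_mod]
    rw [h0, h2, h1, h3]
    ring
  · intro t _ ht
    have := hp t ht
    have h1 : rosePB m (roseRight p) (roseRight t) = 0 := by
      simp [rosePB, roseRight, Nat.add_mod]; omega
    have h2 : rosePB m (roseRight p) (roseLeft t) = 0 := by
      simp [rosePB, roseLeft, roseRight, Nat.add_mod]; omega
    have h3 : rosePB m (roseRight p) (roseTip t) = 0 := by
      simp [rosePB, roseRight, roseTip, Nat.add_mod]; omega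
    rw [h2, h1, h3]
    ring
  · simp

theorem rosePB_tip (p : Fin m) :
    ∑ k, rosePB m (roseTip p) k * u k = (u (roseLeft p) + u (roseRight p)) / 2 := by
  have hp : ∀ t : Fin m, t ≠ p → (t : ℕ) ≠ p := fun t ht h => ht (Fin.ext h)
  have h0 : rosePB m (roseTip p) 0 = 0 := by
    simp [rosePB, roseTip]
  rw [sum_rose, sum_eq_single p]
  · have h1 : rosePB m (roseTip p) (roseLeft p) = 1 / 2 := by
      simp [rosePB, roseLeft, roseTip, Nat.add_mod]
    have h2 : rosePB m (roseTip p) (roseRight p) = 1 / 2 := by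
      simp [rosePB, roseTip, roseRight, Nat.add_mod]
    have h3 : rosePB m (roseTip p) (roseTip p) = 0 := by
      simp [rosePB, roseTip]
    rw [h0, h1, h2, h3]
    ring
  · intro t _ ht
    have := hp t ht
    have h1 : rosePB m (roseTip p) (roseLeft t) = 0 := by
      simp [rosePB, roseLeft, roseTip, Nat.add_mod]; omega
    have h2 : rosePB m (roseTip p) (roseRight t) = 0 := by
      simp [rosePB, roseTip, roseRight, Nat.add_mod]; omega
    have h3 : rosePB m (roseTip p) (roseTip t) = 0 := by
      simp [rosePB, roseTip]; omega
    rw [h1, h2, h3]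
    ring
  · simp

end Step

theorem sum_eq_add_of_forall_ne {m : ℕ} {f : Fin m → ℝ} {c : ℝ} (p : Fin m)
    (h : ∀ t, t ≠ p → f t = c) : ∑ t, f t = f p + ((m : ℝ) - 1) * c := by
  have hm : 1 ≤ m := p.pos
  rw [← add_sum_erase univ f (mem_univ p), sum_congr rfl fun t ht => h t (ne_of_mem_erase ht)]
  simp [card_erase_of_mem, Nat.cast_sub hm]

/-- Hitting times on a petal in terms of the hitting time `h` from the hub, when the target is
not a vertex of the petal; `x`, `y`, `z` are the values at the internal and peripheral vertices. -/
theorem petal_solution {M r h x y z : ℝ} (hM : 0 < M) (hr : 0 < r)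
    (hx : x = 1 + (M / (M + r) * h + r / (M + r) * z))
    (hy : y = 1 + (M / (M + r) * h + r / (M + r) * z))
    (hz : z = 1 + (x + y) / 2) :
    x = h + (M + 2 * r) / M ∧ y = h + (M + 2 * r) / M ∧ z = h + (M + 2 * r) / M + 1 := by
  have hxy : y = x := hy.trans hx.symm
  subst hxy
  have hz' : z = y + 1 := by rw [hz]; ring
  subst hz'
  have hMr : M + r ≠ 0 := by positivity
  have key : y = h + (M + 2 * r) / M := by
    field_simp at hx ⊢
    linarith
  exact ⟨key, key, by rw [key]⟩

section Target

variable {m : ℕ} {u : Fin (3 * m + 1) → ℝ}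

theorem petal_values (p : Fin m)
    (hu : ∀ i, i = roseLeft p ∨ i = roseRight p ∨ i = roseTip p →
      u i = 1 + ∑ k, rosePB m i k * u k) (hr : 0 < √(2 * (m : ℝ) - 1)) :
    u (roseLeft p) = u 0 + (m + 2 * √(2 * (m : ℝ) - 1)) / m ∧
    u (roseRight p) = u 0 + (m + 2 * √(2 * (m : ℝ) - 1)) / m ∧
    u (roseTip p) = u 0 + (m + 2 * √(2 * (m : ℝ) - 1)) / m + 1 := by
  have hm : (0 : ℝ) < m := Nat.cast_pos.mpr p.pos
  have hL := hu (roseLeft p) (by simp)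
  have hR := hu (roseRight p) (by simp)
  have hT := hu (roseTip p) (by simp)
  rw [rosePB_left] at hL
  rw [rosePB_right] at hR
  rw [rosePB_tip] at hT
  exact petal_solution hm hr hL hR hT

/-- The hub equation and the total when the target lies in the petal `p`. -/
theorem petal_target (p : Fin m)
    (hu : ∀ i, i ≠ roseLeft p → i ≠ roseRight p → i ≠ roseTip p →
      u i = 1 + ∑ k, rosePB m i k * u k) (hr : 0 < √(2 * (m : ℝ) - 1)) :
    2 * m * u 0 = 2 * m + (u (roseLeft p) + u (roseRight p)
      + (m - 1) * (2 * (u 0 + (m + 2 * √(2 * (m : ℝ) - 1)) / m))) ∧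
    ∑ i, u i = u 0 + (u (roseLeft p) + u (roseRight p) + u (roseTip p)
      + (m - 1) * (3 * (u 0 + (m + 2 * √(2 * (m : ℝ) - 1)) / m) + 1)) := by
  have hm : (0 : ℝ) < m := Nat.cast_pos.mpr p.pos
  have hpet := fun (t : Fin m) (ht : t ≠ p) =>
    petal_values (u := u) t (fun i hi => by
      have htp : (t : ℕ) ≠ p := fun h => ht (Fin.ext h)
      apply hu <;> rcases hi with rfl | rfl | rfl <;>
        simp only [roseLeft, roseRight, roseTip, ne_eq, Fin.mk.injEq] <;> omega) hr
  constructor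
  · have h0 := hu 0 (by simp [roseLeft, Fin.ext_iff]) (by simp [roseRight, Fin.ext_iff])
      (by simp [roseTip, Fin.ext_iff])
    rw [rosePB_hub, sum_eq_add_of_forall_ne (f := fun t => u (roseLeft t) + u (roseRight t))
      (c := 2 * (u 0 + (m + 2 * √(2 * (m : ℝ) - 1)) / m)) p
      fun t ht => by rw [(hpet t ht).1, (hpet t ht).2.1]; ring] at h0
    generalize (m - 1 : ℝ) * _ = w at h0 ⊢
    field_simp at h0
    linarith
  · rw [sum_rose, sum_eq_add_of_forall_ne
      (f := fun t => u (roseLeft t) + u (roseRight t) + u (roseTip t)) p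
      fun t ht => by
        rw [(hpet t ht).1, (hpet t ht).2.1, (hpet t ht).2.2]]
    ring

end Target

/-- The sum of the hitting times of an internal vertex, from the hub equation and the equations
on its petal. -/
theorem internal_total {M r h y z S : ℝ} (hM : 0 < M) (hr : 0 < r)
    (h0 : 2 * M * h = 2 * M + (y + (M - 1) * (2 * (h + (M + 2 * r) / M))))
    (hy : y = 1 + (M / (M + r) * h + r / (M + r) * z)) (hz : z = 1 + y / 2)
    (hS : S = h + (y + z + (M - 1) * (3 * (h + (M + 2 * r) / M) + 1))) :
    S = (3 * M - 2 + 3 * M / (2 * M + r))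
        * (((M + (M - 1) * (M + 2 * r) / M) * (2 * M + r) + M + 2 * r) / (M + r))
      + 3 * (M + 2 * r) / (2 * M + r) + 1 + (M - 1) * (3 * (M + 2 * r) / M + 1) := by
  have hMr : M + r ≠ 0 := by positivity
  have hMr2 : 2 * M + r ≠ 0 := by positivity
  subst hz
  have hy' : y = (2 * (M + 2 * r) + 2 * M * h) / (2 * M + r) := by
    field_simp at hy ⊢
    linarith
  subst hy'
  have hh : h = ((M + (M - 1) * (M + 2 * r) / M) * (2 * M + r) + M + 2 * r) / (M + r) := by
    field_simp at h0 ⊢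
    linarith
  rw [← hh, hS]
  field_simp
  ring

/-- The sum of the hitting times of a peripheral vertex, from the hub equation and the equations
on its petal. -/
theorem tip_total {M r h x S : ℝ} (hM : 0 < M) (hr : 0 < r)
    (h0 : 2 * M * h = 2 * M + (x + x + (M - 1) * (2 * (h + (M + 2 * r) / M))))
    (hx : x = 1 + M / (M + r) * h)
    (hS : S = h + (x + x + (M - 1) * (3 * (h + (M + 2 * r) / M) + 1))) :
    S = (3 * M - 2 + 2 * M / (M + r)) * ((M + 1 + (M - 1) * (M + 2 * r) / M) * (M + r) / r)
      + 2 + (M - 1) * (3 * (M + 2 * r) / M + 1) := by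
  have hMr : M + r ≠ 0 := by positivity
  subst hx
  have hh : h = (M + 1 + (M - 1) * (M + 2 * r) / M) * (M + r) / r := by
    field_simp at h0 ⊢
    linarith
  rw [← hh, hS]
  field_simp
  ring

/-- Global mean hitting time of the NBCRW on the rose graph `R_m^4` with `N_m = 3m+1`
vertices: `⟨T⟩ = (2m³+12m²-14m+4)/((3m+1)√(2m-1)) + (36m²-8m)/(3(3m+1))`. -/
theorem rose_nbcrw_global_mean_hitting (m : ℕ) (hm : 2 ≤ m)
    (T : Fin (3 * m + 1) → Fin (3 * m + 1) → ℝ)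
    (hdiag : ∀ j, T j j = 0)
    (hstep : ∀ i j : Fin (3 * m + 1), i ≠ j →
      T i j = 1 + ∑ k, rosePB m i k * T k j) :
    (1 / ((3 * (m : ℝ) + 1) * (3 * (m : ℝ)))) * ∑ i, ∑ j, T i j
      = (2 * (m : ℝ) ^ 3 + 12 * (m : ℝ) ^ 2 - 14 * (m : ℝ) + 4)
          / ((3 * (m : ℝ) + 1) * Real.sqrt (2 * (m : ℝ) - 1))
        + (36 * (m : ℝ) ^ 2 - 8 * (m : ℝ)) / (3 * (3 * (m : ℝ) + 1)) := by
  have hm' : (2 : ℝ) ≤ m := by exact_mod_cast hm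
  have hr : 0 < √(2 * (m : ℝ) - 1) := Real.sqrt_pos.mpr (by linarith)
  have hr2 : √(2 * (m : ℝ) - 1) ^ 2 = 2 * (m : ℝ) - 1 := Real.sq_sqrt (by linarith)
  have hM : (0 : ℝ) < m := by linarith
  have hLR : ∀ p : Fin m, roseLeft p ≠ roseRight p := fun p => by simp [roseLeft, roseRight]
  have hLT : ∀ p : Fin m, roseLeft p ≠ roseTip p := fun p => by simp [roseLeft, roseTip]
  have hRT : ∀ p : Fin m, roseRight p ≠ roseTip p := fun p => by simp [roseRight, roseTip]
  have hub : ∑ i, T i 0 = m * (3 * ((m + 2 * √(2 * (m : ℝ) - 1)) / m) + 1) := by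
    have hpet := fun t : Fin m => petal_values (u := fun i => T i 0) t (fun i hi => hstep i 0 (by
      rcases hi with rfl | rfl | rfl <;> simp [roseLeft, roseRight, roseTip, Fin.ext_iff])) hr
    simp only [hdiag] at hpet
    rw [sum_rose, hdiag, sum_congr rfl fun t _ => by
      rw [(hpet t).1, (hpet t).2.1, (hpet t).2.2]]
    simp only [sum_const, card_univ, Fintype.card_fin, nsmul_eq_mul]
    ring
  have left := fun p : Fin m => by
    have htar := petal_target (u := fun i => T i (roseLeft p)) p
      (fun i hi _ _ => hstep i _ hi) hr
    have hR := hstep _ _ (hLR p).symm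
    have hT := hstep _ _ (hLT p).symm
    rw [rosePB_right (fun k => T k (roseLeft p))] at hR
    rw [rosePB_tip (fun k => T k (roseLeft p))] at hT
    simp only [hdiag, zero_add] at htar hT
    exact internal_total hM hr htar.1 hR hT htar.2
  have right := fun p : Fin m => by
    have htar := petal_target (u := fun i => T i (roseRight p)) p
      (fun i _ hi _ => hstep i _ hi) hr
    have hL := hstep _ _ (hLR p)
    have hT := hstep _ _ (hRT p).symm
    rw [rosePB_left (fun k => T k (roseRight p))] at hL
    rw [rosePB_tip (fun k => T k (roseRight p))] at hT
    simp only [hdiag, add_zero] at htar hT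
    exact internal_total hM hr htar.1 hL hT htar.2
  have tip := fun p : Fin m => by
    have htar := petal_target (u := fun i => T i (roseTip p)) p
      (fun i _ _ hi => hstep i _ hi) hr
    have hL := hstep _ _ (hLT p)
    have hR := hstep _ _ (hRT p)
    rw [rosePB_left (fun k => T k (roseTip p))] at hL
    rw [rosePB_right (fun k => T k (roseTip p))] at hR
    simp only [hdiag, add_zero, mul_zero] at htar hL hR
    rw [hR, ← hL] at htar
    exact tip_total hM hr htar.1 hL htar.2
  rw [sum_comm, sum_rose, hub, sum_congr rfl fun p _ => by rw [left p, right p, tip p]]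
  simp only [sum_const, card_univ, Fintype.card_fin, nsmul_eq_mul]
  generalize √(2 * (m : ℝ) - 1) = r at hr hr2 ⊢
  have hmr : (m : ℝ) = (r ^ 2 + 1) / 2 := by linarith
  rw [hmr]
  field_simp
  ring
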